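/- For the TACI problem with bandwidth ratio τ > 0, θ(τ) = H(V|Z) − R(τ), where R(τ) is the optimal rate of the L-helper JSCC problem with the same source distribution P_{U_1…U_L V Z} (the H_0 distribution), the same channels P_{Y_l|X_l}, and the same bandwidth ratio τ. -/

import Mathlib

open Filter Real

noncomputable section

namespace DHT

/-- Real-valued indicator of a proposition. -/
def ind (P : Prop) : ℝ := by classical exact if P then 1 else 0

/-- `p` is a probability mass function on the finite type `α`. -/
def IsPMF {α : Type*} [Fintype α] (p : α → ℝ) : Prop :=
  (∀ a, 0 ≤ p a) ∧ ∑ a, p a = 1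

/-- `f` is a stochastic kernel: every row is a pmf. -/
def IsKernel {α β : Type*} [Fintype β] (f : α → β → ℝ) : Prop :=
  ∀ a, (∀ b, 0 ≤ f a b) ∧ ∑ b, f a b = 1

/-- Pushforward of a pmf along a map. -/
def pushf {α β : Type*} [Fintype α] (p : α → ℝ) (f : α → β) : β → ℝ :=
  fun b => ∑ a, ind (f a = b) * p a

/-- Probability of a set under a pmf. -/
def probIn {α : Type*} [Fintype α] (p : α → ℝ) (A : Set α) : ℝ :=
  ∑ a, ind (a ∈ A) * p a

/-- Shannon entropy, in bits. -/
def entropy {α : Type*} [Fintype α] (p : α → ℝ) : ℝ :=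
  -∑ a, p a * Real.logb 2 (p a)

/-- Kullback–Leibler divergence, in bits. -/
def klDiv {α : Type*} [Fintype α] (p q : α → ℝ) : ℝ :=
  ∑ a, p a * Real.logb 2 (p a / q a)

/-- Conditional entropy `H(α | β)` of a joint pmf on `α × β`, in bits. -/
def condEntropy {α β : Type*} [Fintype α] [Fintype β] (p : α × β → ℝ) : ℝ :=
  -∑ x : α × β, p x * Real.logb 2 (p x / ∑ a, p (a, x.2))

/-- Mutual information `I(α;β)`, in bits. -/
def mutualInfo {α β : Type*} [Fintype α] [Fintype β] (p : α × β → ℝ) : ℝ :=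
  ∑ x : α × β, p x * Real.logb 2 (p x / ((∑ b, p (x.1, b)) * (∑ a, p (a, x.2))))

/-- Conditional mutual information `I(α;β|γ)`, in bits. -/
def condMI {α β γ : Type*} [Fintype α] [Fintype β] [Fintype γ] (p : α × β × γ → ℝ) : ℝ :=
  ∑ x : α × β × γ, p x * Real.logb 2
    (p x * (∑ a, ∑ b, p (a, b, x.2.2)) /
      ((∑ b, p (x.1, b, x.2.2)) * (∑ a, p (a, x.2.1, x.2.2))))

/-- Markov chain `α − β − γ`: the first and third components are conditionally
independent given the middle one. -/
def MarkovChain {α β γ : Type*} [Fintype α] [Fintype γ] (p : α × β × γ → ℝ) : Prop :=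
  ∀ a b c, p (a, b, c) * (∑ a', ∑ c', p (a', b, c')) =
    (∑ c', p (a, b, c')) * (∑ a', p (a', b, c))

/-- Shannon capacity of a discrete memoryless channel, in bits per use. -/
def capacity {X Y : Type*} [Fintype X] [Fintype Y] (Ch : X → Y → ℝ) : ℝ :=
  sSup {c | ∃ q : X → ℝ, IsPMF q ∧ c = mutualInfo (fun xy : X × Y => q xy.1 * Ch xy.1 xy.2)}

/-- Empirical distribution (type) of a length-`j` sequence. -/
def empDist {α : Type*} [Fintype α] {j : ℕ} (w : Fin j → α) : α → ℝ :=
  fun a => (∑ i, ind (w i = a)) / j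

/-- δ-typicality: the empirical distribution is within δ of `p` in every coordinate. -/
def IsTypical {α : Type*} [Fintype α] (p : α → ℝ) (δ : ℝ) {j : ℕ} (w : Fin j → α) : Prop :=
  ∀ a, |empDist w a - p a| ≤ δ

section System

variable {L : ℕ} {U X Y : Fin L → Type} {V Z : Type}
variable [∀ l, Fintype (U l)] [∀ l, Fintype (X l)] [∀ l, Fintype (Y l)]
variable [Fintype V] [Fintype Z]

/-- Joint pmf of the channel outputs `(Y₁ⁿ,…,Y_Lⁿ)`, `V^k` and `Z^k` induced by `k` i.i.d.
copies of the source `R`, the stochastic encoders `f` and the memoryless channels `Ch`. -/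
def inducedDist (R : (((l : Fin L) → U l) × V × Z) → ℝ)
    (Ch : (l : Fin L) → X l → Y l → ℝ) (k n : ℕ)
    (f : (l : Fin L) → (Fin k → U l) → (Fin n → X l) → ℝ) :
    (((l : Fin L) → Fin n → Y l) × (Fin k → V) × (Fin k → Z)) → ℝ :=
  fun yvz =>
    ∑ u : (l : Fin L) → Fin k → U l, ∑ x : (l : Fin L) → Fin n → X l,
      (∏ i : Fin k, R ((fun l => u l i), yvz.2.1 i, yvz.2.2 i)) *
        ((∏ l, f l (u l) (x l)) * ∏ l, ∏ j : Fin n, Ch l (x l j) (yvz.1 l j))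

/-- `P` and `Q` have the same single-variable marginals. -/
def SameMarginals (P Q : (((l : Fin L) → U l) × V × Z) → ℝ) : Prop :=
  (∀ (l : Fin L) (a : U l),
      (∑ x : ((l : Fin L) → U l) × V × Z, ind (x.1 l = a) * P x) =
        ∑ x : ((l : Fin L) → U l) × V × Z, ind (x.1 l = a) * Q x) ∧
  (∀ v : V, (∑ x : ((l : Fin L) → U l) × V × Z, ind (x.2.1 = v) * P x) =
      ∑ x : ((l : Fin L) → U l) × V × Z, ind (x.2.1 = v) * Q x) ∧
  (∀ z : Z, (∑ x : ((l : Fin L) → U l) × V × Z, ind (x.2.2 = z) * P x) =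
      ∑ x : ((l : Fin L) → U l) × V × Z, ind (x.2.2 = z) * Q x)

/-- Testing against conditional independence: `Q = P_{U_𝓛|Z} P_{V|Z} P_Z`. -/
def IsTACI (P Q : (((l : Fin L) → U l) × V × Z) → ℝ) : Prop :=
  ∀ x : ((l : Fin L) → U l) × V × Z,
    Q x = (∑ v : V, P (x.1, v, x.2.2)) * (∑ u : (l : Fin L) → U l, P (u, x.2.1, x.2.2)) /
      (∑ u : (l : Fin L) → U l, ∑ v : V, P (u, v, x.2.2))

/-- Optimal type-2 error probability `β(k,τ,ε)`. -/
def beta (P Q : (((l : Fin L) → U l) × V × Z) → ℝ)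
    (Ch : (l : Fin L) → X l → Y l → ℝ) (τ ε : ℝ) (k : ℕ) : ℝ :=
  sInf {b | ∃ n : ℕ, (n : ℝ) ≤ τ * k ∧
    ∃ f : (l : Fin L) → (Fin k → U l) → (Fin n → X l) → ℝ,
      (∀ l, IsKernel (f l)) ∧
      ∃ A : Set (((l : Fin L) → Fin n → Y l) × (Fin k → V) × (Fin k → Z)),
        probIn (inducedDist P Ch k n f) Aᶜ ≤ ε ∧
        b = probIn (inducedDist Q Ch k n f) A}

/-- `θ(k,τ)`. -/
def thetaK (P Q : (((l : Fin L) → U l) × V × Z) → ℝ)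
    (Ch : (l : Fin L) → X l → Y l → ℝ) (τ : ℝ) (k : ℕ) : ℝ :=
  sSup {d | ∃ n : ℕ, (n : ℝ) ≤ τ * k ∧
    ∃ f : (l : Fin L) → (Fin k → U l) → (Fin n → X l) → ℝ,
      (∀ l, IsKernel (f l)) ∧
      d = klDiv (inducedDist P Ch k n f) (inducedDist Q Ch k n f) / k}

/-- `θ(τ) = sup_{k ≥ 1} θ(k,τ)`. -/
def theta (P Q : (((l : Fin L) → U l) × V × Z) → ℝ)
    (Ch : (l : Fin L) → X l → Y l → ℝ) (τ : ℝ) : ℝ :=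
  sSup {d | ∃ k : ℕ, 1 ≤ k ∧ d = thetaK P Q Ch τ k}

/-- Optimal type-2 error exponent `κ(τ,ε)`. -/
def kappa (P Q : (((l : Fin L) → U l) × V × Z) → ℝ)
    (Ch : (l : Fin L) → X l → Y l → ℝ) (τ ε : ℝ) : ℝ :=
  sSup {κ : ℝ | 0 ≤ κ ∧ ∀ δ : ℝ, 0 < δ →
    Filter.limsup (fun k : ℕ => Real.logb 2 (beta P Q Ch τ ε k) / k) Filter.atTop ≤ -(κ - δ)}

/-- `I(V^k; Y₁ⁿ,…,Y_Lⁿ | Z^k)` of the induced distribution. -/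
def miVY (P : (((l : Fin L) → U l) × V × Z) → ℝ)
    (Ch : (l : Fin L) → X l → Y l → ℝ) (k n : ℕ)
    (f : (l : Fin L) → (Fin k → U l) → (Fin n → X l) → ℝ) : ℝ :=
  condMI (fun x : (Fin k → V) × ((l : Fin L) → Fin n → Y l) × (Fin k → Z) =>
    inducedDist P Ch k n f (x.2.1, x.1, x.2.2))

/-- `H(V^k | Y₁ⁿ,…,Y_Lⁿ, Z^k)` of the induced distribution. -/
def condEntV (P : (((l : Fin L) → U l) × V × Z) → ℝ)
    (Ch : (l : Fin L) → X l → Y l → ℝ) (k n : ℕ)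
    (f : (l : Fin L) → (Fin k → U l) → (Fin n → X l) → ℝ) : ℝ :=
  condEntropy (fun x : (Fin k → V) × (((l : Fin L) → Fin n → Y l) × (Fin k → Z)) =>
    inducedDist P Ch k n f (x.2.1, x.1, x.2.2))

/-- Probability of correct decoding in the `L`-helper JSCC problem. -/
def probCorrect (P : (((l : Fin L) → U l) × V × Z) → ℝ)
    (Ch : (l : Fin L) → X l → Y l → ℝ) (k n m : ℕ)
    (f : (l : Fin L) → (Fin k → U l) → (Fin n → X l) → ℝ)
    (φ : (Fin k → V) → Fin m)
    (g : Fin m × ((l : Fin L) → Fin n → Y l) × (Fin k → Z) → (Fin k → V)) : ℝ :=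
  ∑ w : ((l : Fin L) → Fin n → Y l) × (Fin k → V) × (Fin k → Z),
    ind (g (φ w.2.1, w.1, w.2.2) = w.2.1) * inducedDist P Ch k n f w

/-- Achievability of rate `R` in the `L`-helper JSCC problem with bandwidth ratio `τ`. -/
def JSCCAchievable (P : (((l : Fin L) → U l) × V × Z) → ℝ)
    (Ch : (l : Fin L) → X l → Y l → ℝ) (τ R : ℝ) : Prop :=
  ∀ lam : ℝ, 0 < lam → lam ≤ 1 →
    ∃ (nseq mseq : ℕ → ℕ) (δ : ℕ → ℝ)
      (f : (k : ℕ) → (l : Fin L) → (Fin k → U l) → (Fin (nseq k) → X l) → ℝ)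
      (φ : (k : ℕ) → (Fin k → V) → Fin (mseq k))
      (g : (k : ℕ) → Fin (mseq k) × ((l : Fin L) → Fin (nseq k) → Y l) × (Fin k → Z) →
        (Fin k → V)),
      (∀ k, 0 ≤ δ k) ∧ Filter.Tendsto δ Filter.atTop (nhds 0) ∧
      ∀ k : ℕ, 1 ≤ k →
        (nseq k : ℝ) ≤ τ * k ∧ 1 ≤ mseq k ∧ (∀ l, IsKernel (f k l)) ∧
        1 - lam ≤ probCorrect P Ch k (nseq k) (mseq k) (f k) (φ k) (g k) ∧
        Real.logb 2 (mseq k) / k ≤ R + δ k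

/-- Optimal rate `R(τ)` of the `L`-helper JSCC problem. -/
def Rjscc (P : (((l : Fin L) → U l) × V × Z) → ℝ)
    (Ch : (l : Fin L) → X l → Y l → ℝ) (τ : ℝ) : ℝ :=
  sInf {R | JSCCAchievable P Ch τ R}

/-- `R_k`: infimum of `H(V^k|Y^n,Z^k)/k` over block lengths `n ≤ τk` and encoders. -/
def Rk (P : (((l : Fin L) → U l) × V × Z) → ℝ)
    (Ch : (l : Fin L) → X l → Y l → ℝ) (τ : ℝ) (k : ℕ) : ℝ :=
  sInf {r | ∃ n : ℕ, (n : ℝ) ≤ τ * k ∧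
    ∃ f : (l : Fin L) → (Fin k → U l) → (Fin n → X l) → ℝ,
      (∀ l, IsKernel (f l)) ∧ r = condEntV P Ch k n f / k}

end System

section SingleObserver

variable {Uu Xx Yy V Z : Type}
variable [Fintype Uu] [Fintype Xx] [Fintype Yy] [Fintype V] [Fintype Z]

/-- Single-observer induced joint pmf of `(Yⁿ, V^k, Z^k)`. -/
def inducedDist1 (R : Uu × V × Z → ℝ) (Ch : Xx → Yy → ℝ) (k n : ℕ)
    (f : (Fin k → Uu) → (Fin n → Xx) → ℝ) :
    ((Fin n → Yy) × (Fin k → V) × (Fin k → Z)) → ℝ :=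
  fun yvz => ∑ u : Fin k → Uu, ∑ x : Fin n → Xx,
    (∏ i : Fin k, R (u i, yvz.2.1 i, yvz.2.2 i)) *
      (f u x * ∏ j : Fin n, Ch (x j) (yvz.1 j))

end SingleObserver

section Aux

variable {Uu V Z Wt : Type} [Fintype Uu] [Fintype V] [Fintype Z] [Fintype Wt]

/-- Markov chain `(Z,V) − U − W` for a joint pmf on `(U × V × Z) × W`. -/
def MarkovZVUW (J : (Uu × V × Z) × Wt → ℝ) : Prop :=
  MarkovChain (fun x : (Z × V) × Uu × Wt => J ((x.2.1, x.1.2, x.1.1), x.2.2))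

/-- `I(U;W|Z)` for a joint pmf on `(U × V × Z) × W`. -/
def miUW_Z (J : (Uu × V × Z) × Wt → ℝ) : ℝ :=
  condMI (fun x : Uu × Wt × Z => ∑ v, J ((x.1, v, x.2.2), x.2.1))

/-- `I(V;W|Z)` for a joint pmf on `(U × V × Z) × W`. -/
def miVW_Z (J : (Uu × V × Z) × Wt → ℝ) : ℝ :=
  condMI (fun x : V × Wt × Z => ∑ u, J ((u, x.1, x.2.2), x.2.1))

/-- `I(U;W|V,Z)` for a joint pmf on `(U × V × Z) × W`. -/
def miUW_VZ (J : (Uu × V × Z) × Wt → ℝ) : ℝ :=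
  condMI (fun x : Uu × Wt × (V × Z) => J ((x.1, x.2.2.1, x.2.2.2), x.2.1))

/-- `H(V|W,Z)` for a joint pmf on `(U × V × Z) × W`. -/
def entV_WZ (J : (Uu × V × Z) × Wt → ℝ) : ℝ :=
  condEntropy (fun x : V × (Wt × Z) => ∑ u, J ((u, x.1, x.2.2), x.2.1))

/-- `H(V|Z)` for a joint pmf on `U × V × Z`. -/
def entV_Z (P : Uu × V × Z → ℝ) : ℝ :=
  condEntropy (fun x : V × Z => ∑ u, P (u, x.1, x.2))

end Aux

end DHT

open DHT Filter Real

namespace DHT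

lemma ind_true {p : Prop} (h : p) : ind p = 1 := by simp [ind, h]

lemma ind_false {p : Prop} (h : ¬p) : ind p = 0 := by simp [ind, h]

lemma ind_nonneg (p : Prop) : 0 ≤ ind p := by
  by_cases h : p <;> simp [ind, h]

lemma ind_le_one (p : Prop) : ind p ≤ 1 := by
  by_cases h : p <;> simp [ind, h]

section Abstract

variable {α σ : Type*} [Fintype α]

lemma le_marginal {p : α × σ → ℝ} (hp : ∀ x, 0 ≤ p x) (x : α × σ) :
    p x ≤ ∑ a, p (a, x.2) :=
  Finset.single_le_sum (f := fun a => p (a, x.2)) (fun _ _ => hp _) (Finset.mem_univ x.1)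

variable [Fintype σ]

lemma condEntropy_nonneg {p : α × σ → ℝ} (hp : ∀ x, 0 ≤ p x) : 0 ≤ condEntropy p := by
  unfold condEntropy
  rw [neg_nonneg]
  refine Finset.sum_nonpos fun x _ => mul_nonpos_of_nonneg_of_nonpos (hp x) ?_
  have h := le_marginal hp x
  exact Real.logb_nonpos one_lt_two (div_nonneg (hp x) ((hp x).trans h))
    (div_le_one_of_le₀ h ((hp x).trans h))

/-- Gibbs' inequality for conditional entropy against a sub-stochastic kernel. -/
lemma condEntropy_le_cross {p : α × σ → ℝ} (hp : ∀ x, 0 ≤ p x) {q : α × σ → ℝ}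
    (hq : ∀ x, 0 < q x) (hq1 : ∀ s, ∑ a, q (a, s) ≤ 1) :
    condEntropy p ≤ -∑ x, p x * Real.logb 2 (q x) := by
  have key : ∀ x, p x - (∑ a, p (a, x.2)) * q x ≤
      (p x * Real.logb 2 (p x / ∑ a, p (a, x.2)) - p x * Real.logb 2 (q x)) * Real.log 2 := by
    intro x
    have hm := le_marginal hp x
    rcases (hp x).eq_or_lt with h0 | h0
    · rw [← h0] at hm ⊢
      simp only [zero_mul, sub_self, zero_sub, Left.neg_nonpos_iff]
      exact mul_nonneg hm (hq x).le
    · set m := ∑ a, p (a, x.2)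
      have hm0 : 0 < m := h0.trans_le hm
      have hlog : Real.log 2 ≠ 0 := (Real.log_pos one_lt_two).ne'
      have e : (p x * Real.logb 2 (p x / m) - p x * Real.logb 2 (q x)) * Real.log 2 =
          p x * (-Real.log (m * q x / p x)) := by
        rw [Real.logb, Real.logb, Real.log_div h0.ne' hm0.ne',
          Real.log_div (mul_pos hm0 (hq x)).ne' h0.ne', Real.log_mul hm0.ne' (hq x).ne']
        field_simp
        ring
      rw [e]
      have h := Real.log_le_sub_one_of_pos (div_pos (mul_pos hm0 (hq x)) h0)
      calc p x - m * q x = p x * (-(m * q x / p x - 1)) := by field_simp; ring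
        _ ≤ _ := by gcongr
  have hsum := Finset.sum_le_sum fun x (_ : x ∈ Finset.univ) => key x
  rw [← Finset.sum_mul, Finset.sum_sub_distrib, Finset.sum_sub_distrib] at hsum
  have h1 : ∑ x : α × σ, (∑ a, p (a, x.2)) * q x ≤ ∑ x, p x := by
    rw [Fintype.sum_prod_type_right, Fintype.sum_prod_type_right]
    refine Finset.sum_le_sum fun s _ => ?_
    dsimp only
    rw [← Finset.mul_sum]
    exact mul_le_of_le_one_right (Finset.sum_nonneg fun a _ => hp _) (hq1 s)
  have h2 := nonneg_of_mul_nonneg_left ((sub_nonneg.2 h1).trans hsum) (Real.log_pos one_lt_two)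
  unfold condEntropy
  linarith

/-- Fano's inequality with a side message of `m` values. -/
lemma condEntropy_le_of_decoder [Nonempty α] {p : α × σ → ℝ} (hp : IsPMF p) {m : ℕ} (hm : 1 ≤ m)
    (φ : α → Fin m) (g : Fin m × σ → α) {lam : ℝ}
    (hc : 1 - lam ≤ ∑ x, ind (g (φ x.1, x.2) = x.1) * p x) :
    condEntropy p ≤ 1 + Real.logb 2 m + lam * Real.logb 2 (Fintype.card α) := by
  have hm0 : (0 : ℝ) < m := by exact_mod_cast hm
  have hα : (1 : ℝ) ≤ Fintype.card α := by exact_mod_cast Fintype.card_pos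
  set N : ℝ := (Fintype.card α : ℝ) with hN
  have hN0 : 0 < N := by linarith
  set q : α × σ → ℝ := fun x => (∑ b, ind (g (b, x.2) = x.1)) * (1 / (2 * m)) + 1 / (2 * N)
  have hS : ∀ x : α × σ, 0 ≤ (∑ b, ind (g (b, x.2) = x.1)) * (1 / (2 * (m : ℝ))) := fun x =>
    mul_nonneg (Finset.sum_nonneg fun _ _ => ind_nonneg _) (by positivity)
  have hlow : ∀ x, 1 / (2 * N) ≤ q x := fun x => by have := hS x; simp only [q]; linarith
  have hq : ∀ x, 0 < q x := fun x => lt_of_lt_of_le (by positivity) (hlow x)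
  have hq1 : ∀ s, ∑ a, q (a, s) ≤ 1 := by
    intro s
    simp only [q]
    rw [Finset.sum_add_distrib, ← Finset.sum_mul, Finset.sum_comm]
    have : ∀ b, ∑ a, ind (g (b, s) = a) = 1 := by
      intro b
      classical
      simp [ind]
    simp only [this, Finset.sum_const, Finset.card_univ, Fintype.card_fin, nsmul_eq_mul, ← hN]
    apply le_of_eq
    field_simp
    norm_num
  refine (condEntropy_le_cross hp.1 hq hq1).trans ?_
  have hlogm : 0 ≤ Real.logb 2 m := Real.logb_nonneg one_lt_two (by exact_mod_cast hm)
  have hlogN : 0 ≤ Real.logb 2 N := Real.logb_nonneg one_lt_two hα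
  have key : ∀ x, -Real.logb 2 (q x) ≤ 1 + Real.logb 2 m +
      (1 - ind (g (φ x.1, x.2) = x.1)) * Real.logb 2 N := by
    intro x
    by_cases h : g (φ x.1, x.2) = x.1
    · rw [ind_true h]
      have hle : 1 / (2 * (m : ℝ)) ≤ q x := by
        have h1 : 1 ≤ ∑ b, ind (g (b, x.2) = x.1) := by
          rw [← ind_true h]
          exact Finset.single_le_sum (f := fun b => ind (g (b, x.2) = x.1))
            (fun _ _ => ind_nonneg _) (Finset.mem_univ _)
        have h2 : (1 : ℝ) / (2 * m) ≤ (∑ b, ind (g (b, x.2) = x.1)) * (1 / (2 * m)) :=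
          le_mul_of_one_le_left (by positivity) h1
        have h3 : 0 < 1 / (2 * N) := by positivity
        simp only [q]
        linarith
      have := Real.logb_le_logb_of_le one_lt_two (by positivity) hle
      rw [one_div, Real.logb_inv, Real.logb_mul two_ne_zero hm0.ne',
        Real.logb_self_eq_one one_lt_two] at this
      linarith
    · rw [ind_false h]
      have := Real.logb_le_logb_of_le one_lt_two (by positivity) (hlow x)
      rw [one_div, Real.logb_inv, Real.logb_mul two_ne_zero hN0.ne',
        Real.logb_self_eq_one one_lt_two] at this
      linarith
  calc -∑ x, p x * Real.logb 2 (q x) = ∑ x, p x * -Real.logb 2 (q x) := by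
        simp [Finset.sum_neg_distrib]
    _ ≤ ∑ x, p x * (1 + Real.logb 2 m + (1 - ind (g (φ x.1, x.2) = x.1)) * Real.logb 2 N) :=
        Finset.sum_le_sum fun x _ => mul_le_mul_of_nonneg_left (key x) (hp.1 x)
    _ = (∑ x, p x) * (1 + Real.logb 2 m + Real.logb 2 N) -
          (∑ x, ind (g (φ x.1, x.2) = x.1) * p x) * Real.logb 2 N := by
        rw [Finset.sum_mul, Finset.sum_mul, ← Finset.sum_sub_distrib]
        exact Finset.sum_congr rfl fun x _ => by ring
    _ ≤ _ := by
        rw [hp.2]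
        nlinarith

/-- Two distinct points collide under a uniformly random binning with probability `1 / m`. -/
lemma sum_collision [DecidableEq α] {m : ℕ} [NeZero m] {v w : α} (h : v ≠ w) :
    (m : ℝ) * ∑ φ : α → Fin m, ind (φ w = φ v) = Fintype.card (α → Fin m) := by
  have hc : ∀ c : Fin m, ∑ φ : α → Fin m, ind (φ w = φ v) =
      ∑ φ : α → Fin m, ind (φ w + c = φ v) := by
    intro c
    rw [← Equiv.sum_comp (Equiv.addRight (Pi.single w c : α → Fin m))]
    simp [h]
  have : ∑ c : Fin m, ∑ φ : α → Fin m, ind (φ w = φ v) =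
      ∑ c : Fin m, ∑ φ : α → Fin m, ind (φ w + c = φ v) := Finset.sum_congr rfl fun c _ => hc c
  have h1 : ∀ φ : α → Fin m, ∑ c, ind (φ w + c = φ v) = 1 := by
    intro φ
    have : ∀ c, (φ w + c = φ v) = (c = φ v - φ w) := fun c => by
      rw [eq_sub_iff_add_eq, add_comm]
    simp [this, ind]
  have h2 : ∑ c : Fin m, ∑ φ : α → Fin m, ind (φ w + c = φ v) = Fintype.card (α → Fin m) := by
    rw [Finset.sum_comm]
    simp [h1]
  rw [h2] at this
  simpa using this

/-- Random binning with a conditionally small list `T`. -/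
lemma exists_binning [Nonempty α] {p : α × σ → ℝ} (hp : IsPMF p) (T : α → σ → Prop) {M : ℝ}
    (hT : ∀ s, ∑ a, ind (T a s) ≤ M) {m : ℕ} (hm : 1 ≤ m) :
    ∃ (φ : α → Fin m) (g : Fin m × σ → α),
      ∑ x : α × σ, ind (T x.1 x.2) * p x - M / m ≤ ∑ x, ind (g (φ x.1, x.2) = x.1) * p x := by
  classical
  have : NeZero m := ⟨by omega⟩
  have hm0 : (0 : ℝ) < m := by exact_mod_cast hm
  let dec : (α → Fin m) → Fin m × σ → α := fun φ bs =>
    if h : ∃ v, T v bs.2 ∧ φ v = bs.1 then h.choose else Classical.arbitrary α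
  let coll : (α → Fin m) → α × σ → ℝ := fun φ x =>
    ∑ w, (if w = x.1 then 0 else ind (T w x.2) * ind (φ w = φ x.1))
  have hcoll0 : ∀ φ x, 0 ≤ coll φ x := fun φ x => Finset.sum_nonneg fun w _ => by
    split_ifs
    · exact le_rfl
    · exact mul_nonneg (ind_nonneg _) (ind_nonneg _)
  have hdec : ∀ φ x, ind (T x.1 x.2) - coll φ x ≤ ind (dec φ (φ x.1, x.2) = x.1) := by
    intro φ x
    by_cases hd : dec φ (φ x.1, x.2) = x.1
    · rw [ind_true hd]
      linarith [ind_le_one (T x.1 x.2), hcoll0 φ x]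
    · by_cases ht : T x.1 x.2
      · rw [ind_true ht, ind_false hd, sub_nonpos]
        have hex : ∃ v, T v x.2 ∧ φ v = φ x.1 := ⟨x.1, ht, rfl⟩
        have hde : dec φ (φ x.1, x.2) = hex.choose := dif_pos hex
        have hs := hex.choose_spec
        rw [← hde] at hs
        have := Finset.single_le_sum
          (f := fun w => if w = x.1 then 0 else ind (T w x.2) * ind (φ w = φ x.1))
          (fun w _ => by
            split_ifs
            · exact le_rfl
            · exact mul_nonneg (ind_nonneg _) (ind_nonneg _))
          (Finset.mem_univ (dec φ (φ x.1, x.2)))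
        simpa [hd, ind_true hs.1, ind_true hs.2] using this
      · rw [ind_false ht]
        linarith [ind_nonneg (dec φ (φ x.1, x.2) = x.1), hcoll0 φ x]
  set K : ℝ := (Fintype.card (α → Fin m) : ℝ) with hK
  have havg : ∀ x, ∑ φ, coll φ x ≤ K * (M / m) := by
    intro x
    simp only [coll]
    rw [Finset.sum_comm]
    calc ∑ w, ∑ φ : α → Fin m, (if w = x.1 then 0 else ind (T w x.2) * ind (φ w = φ x.1))
        ≤ ∑ w, ind (T w x.2) * (K / m) := by
          refine Finset.sum_le_sum fun w _ => ?_
          by_cases hw : w = x.1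
          · simp only [hw, if_true, Finset.sum_const_zero]
            exact mul_nonneg (ind_nonneg _) (by positivity)
          · simp only [hw, if_false, ← Finset.mul_sum]
            rw [hK, ← sum_collision (m := m) (Ne.symm hw), mul_div_cancel_left₀ _ hm0.ne']
      _ = (∑ w, ind (T w x.2)) * (K / m) := by rw [Finset.sum_mul]
      _ ≤ M * (K / m) := mul_le_mul_of_nonneg_right (hT x.2) (by positivity)
      _ = _ := by ring
  obtain ⟨φ, -, hφ⟩ := Finset.exists_le_of_sum_le (s := (Finset.univ : Finset (α → Fin m)))
    (f := fun _ => ∑ x : α × σ, ind (T x.1 x.2) * p x - M / m)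
    (g := fun φ => ∑ x : α × σ, ind (dec φ (φ x.1, x.2) = x.1) * p x) Finset.univ_nonempty (by
      calc ∑ _φ : α → Fin m, (∑ x : α × σ, ind (T x.1 x.2) * p x - M / m)
          = ∑ x : α × σ, p x * (K * ind (T x.1 x.2) - K * (M / m)) := by
            simp only [mul_sub, Finset.sum_sub_distrib, ← Finset.sum_mul, hp.2, Finset.sum_const,
              Finset.card_univ, nsmul_eq_mul, ← hK, one_mul, Finset.mul_sum]
            congr 1
            exact Finset.sum_congr rfl fun x _ => by ring
        _ ≤ ∑ x : α × σ, p x * ∑ φ, (ind (T x.1 x.2) - coll φ x) := by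
            refine Finset.sum_le_sum fun x _ => mul_le_mul_of_nonneg_left ?_ (hp.1 x)
            rw [Finset.sum_sub_distrib]
            simp only [Finset.sum_const, Finset.card_univ, nsmul_eq_mul, ← hK]
            linarith [havg x]
        _ ≤ ∑ x : α × σ, p x * ∑ φ : α → Fin m, ind (dec φ (φ x.1, x.2) = x.1) :=
            Finset.sum_le_sum fun x _ => mul_le_mul_of_nonneg_left
              (Finset.sum_le_sum fun φ _ => hdec φ x) (hp.1 x)
        _ = _ := by
            simp only [Finset.mul_sum]
            rw [Finset.sum_comm]
            exact Finset.sum_congr rfl fun φ _ => Finset.sum_congr rfl fun x _ => mul_comm _ _)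
  exact ⟨φ, dec φ, hφ⟩

end Abstract

section Product

variable {β : Type*} [Fintype β]

/-- Expectation of a sum of functions of the coordinates under a product pmf. -/
lemma sum_prod_mul_sum {p : β → ℝ} (hp : ∑ b, p b = 1) (g : β → ℝ) (j : ℕ) :
    ∑ x : Fin j → β, (∏ i, p (x i)) * ∑ i, g (x i) = j * ∑ b, p b * g b := by
  induction j with
  | zero => simp
  | succ j ih =>
    rw [← Equiv.sum_comp (Fin.consEquiv fun _ => β), Fintype.sum_prod_type]
    have h1 : ∑ x : Fin j → β, ∏ i, p (x i) = 1 := by rw [← Fintype.sum_pow, hp, one_pow]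
    have e : ∀ (b : β) (x : Fin j → β), p b * (∏ i, p (x i)) * (g b + ∑ i, g (x i)) =
        p b * g b * (∏ i, p (x i)) + p b * ((∏ i, p (x i)) * ∑ i, g (x i)) := fun b x => by ring
    simp only [Fin.consEquiv_apply, Fin.prod_univ_succ, Fin.sum_univ_succ, Fin.cons_zero,
      Fin.cons_succ, e, Finset.sum_add_distrib, ← Finset.mul_sum, ih, h1, ← Finset.sum_mul, hp]
    push_cast
    ring

/-- Second moment of a sum of centred functions of the coordinates under a product pmf. -/
lemma sum_prod_mul_sq {p : β → ℝ} (hp : ∑ b, p b = 1) {g : β → ℝ} (hg : ∑ b, p b * g b = 0)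
    (j : ℕ) :
    ∑ x : Fin j → β, (∏ i, p (x i)) * (∑ i, g (x i)) ^ 2 = j * ∑ b, p b * g b ^ 2 := by
  induction j with
  | zero => simp
  | succ j ih =>
    rw [← Equiv.sum_comp (Fin.consEquiv fun _ => β), Fintype.sum_prod_type]
    have h1 : ∑ x : Fin j → β, ∏ i, p (x i) = 1 := by rw [← Fintype.sum_pow, hp, one_pow]
    have e : ∀ (b : β) (x : Fin j → β), p b * (∏ i, p (x i)) * (g b + ∑ i, g (x i)) ^ 2 =
        p b * g b ^ 2 * (∏ i, p (x i)) + p b * g b * (2 * ((∏ i, p (x i)) * ∑ i, g (x i))) +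
          p b * ((∏ i, p (x i)) * (∑ i, g (x i)) ^ 2) := fun b x => by ring
    simp only [Fin.consEquiv_apply, Fin.prod_univ_succ, Fin.sum_univ_succ, Fin.cons_zero,
      Fin.cons_succ, e, Finset.sum_add_distrib, ← Finset.mul_sum, ih, h1, ← Finset.sum_mul, hp, hg]
    push_cast
    ring

end Product

section SlepianWolf

variable {α σ : Type*} [Fintype α]

/-- Sequences of strictly positive probability whose conditional self-information under `p` is
at most `γ`. -/
def CondTypical (p : α × σ → ℝ) (γ : ℝ) {j : ℕ} (v : Fin j → α) (s : Fin j → σ) : Prop :=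
  (∀ i, 0 < p (v i, s i)) ∧
    ∑ i, -Real.logb 2 (p (v i, s i) / ∑ a, p (a, s i)) ≤ γ

lemma sum_condTypical_le {p : α × σ → ℝ} (hp : ∀ x, 0 ≤ p x) (γ : ℝ) {j : ℕ} (s : Fin j → σ) :
    ∑ v : Fin j → α, ind (CondTypical p γ v s) ≤ (2 : ℝ) ^ γ := by
  classical
  set mS : ℝ := ∏ i, ∑ a, p (a, s i) with hmS
  have hmS0 : 0 ≤ mS := Finset.prod_nonneg fun i _ => Finset.sum_nonneg fun a _ => hp _
  have hsum : ∑ v : Fin j → α, ∏ i, p (v i, s i) = mS := by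
    rw [hmS, Fintype.prod_sum]
  have key : ∀ v : Fin j → α, CondTypical p γ v s →
      0 < mS ∧ mS ≤ (2 : ℝ) ^ γ * ∏ i, p (v i, s i) := by
    rintro v ⟨hv, hle⟩
    have hpos : ∀ i, 0 < ∑ a, p (a, s i) := fun i => (hv i).trans_le (le_marginal hp (v i, s i))
    refine ⟨Finset.prod_pos fun i _ => hpos i, ?_⟩
    have e : mS = (2 : ℝ) ^ (∑ i, -Real.logb 2 (p (v i, s i) / ∑ a, p (a, s i))) *
        ∏ i, p (v i, s i) := by
      rw [Real.rpow_sum_of_pos two_pos, ← Finset.prod_mul_distrib]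
      refine Finset.prod_congr rfl fun i _ => ?_
      rw [Real.rpow_neg two_pos.le, Real.rpow_logb two_pos (by norm_num)
        (div_pos (hv i) (hpos i))]
      have := (hv i).ne'
      field_simp
    rw [e]
    exact mul_le_mul_of_nonneg_right (Real.rpow_le_rpow_of_exponent_le one_le_two hle)
      (Finset.prod_nonneg fun i _ => hp _)
  rcases hmS0.eq_or_lt with h0 | h0
  · rw [Finset.sum_eq_zero fun v _ => ind_false fun h => (key v h).1.ne h0]
    positivity
  · refine le_of_mul_le_mul_right ?_ h0
    rw [Finset.sum_mul]
    nth_rw 2 [← hsum]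
    rw [Finset.mul_sum]
    refine Finset.sum_le_sum fun v _ => ?_
    by_cases h : CondTypical p γ v s
    · rw [ind_true h, one_mul]
      exact (key v h).2
    · rw [ind_false h, zero_mul]
      exact mul_nonneg (by positivity) (Finset.prod_nonneg fun i _ => hp _)

variable [Fintype σ]

lemma sum_arrow_prod {j : ℕ} (F : (Fin j → α × σ) → ℝ) :
    ∑ x : (Fin j → α) × (Fin j → σ), F (fun i => (x.1 i, x.2 i)) = ∑ w, F w :=
  Equiv.sum_comp (Equiv.arrowProdEquivProdArrow (Fin j) (fun _ => α) (fun _ => σ)).symm F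

lemma prob_condTypical_ge {p : α × σ → ℝ} (hp : IsPMF p) {ε : ℝ} (hε : 0 < ε) :
    ∃ C : ℝ, ∀ j : ℕ, 1 ≤ j → 1 - C / j ≤ ∑ x : (Fin j → α) × (Fin j → σ),
      ind (CondTypical p (j * (condEntropy p + ε)) x.1 x.2) * ∏ i, p (x.1 i, x.2 i) := by
  set h : α × σ → ℝ := fun x => -Real.logb 2 (p x / ∑ a, p (a, x.2)) with hh
  set H := condEntropy p with hH
  have hHsum : ∑ x, p x * h x = H := by
    simp [hh, hH, condEntropy, Finset.sum_neg_distrib]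
  set g : α × σ → ℝ := fun x => h x - H with hg
  have hg0 : ∑ x, p x * g x = 0 := by
    simp only [hg, mul_sub, Finset.sum_sub_distrib, hHsum, ← Finset.sum_mul, hp.2]
    ring
  refine ⟨(∑ x, p x * g x ^ 2) / ε ^ 2, fun j hj => ?_⟩
  have hj0 : (0 : ℝ) < j := by exact_mod_cast hj
  have hpw : ∀ w : Fin j → α × σ, (∏ i, p (w i)) - (∏ i, p (w i)) * (∑ i, g (w i)) ^ 2 *
      (1 / (j * ε) ^ 2) ≤ ind (CondTypical p (j * (H + ε)) (fun i => (w i).1) (fun i => (w i).2)) *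
        ∏ i, p (w i) := by
    intro w
    have hw0 : 0 ≤ ∏ i, p (w i) := Finset.prod_nonneg fun i _ => hp.1 _
    by_cases hT : CondTypical p (j * (H + ε)) (fun i => (w i).1) (fun i => (w i).2)
    · rw [ind_true hT, one_mul, sub_le_self_iff]
      positivity
    · rw [ind_false hT, zero_mul, sub_nonpos]
      rcases hw0.eq_or_lt with h0 | h0
      · rw [← h0]; simp
      · have hpos : ∀ i, 0 < p (w i) := fun i => (hp.1 _).lt_of_ne fun he =>
          h0.ne' (Finset.prod_eq_zero (Finset.mem_univ i) he.symm)
        have hlt : j * (H + ε) < ∑ i, h (w i) := by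
          by_contra hcon
          exact hT ⟨hpos, not_lt.1 hcon⟩
        have hS : j * ε ≤ ∑ i, g (w i) := by
          simp only [hg, Finset.sum_sub_distrib, Finset.sum_const, Finset.card_univ,
            Fintype.card_fin, nsmul_eq_mul]
          linarith
        rw [mul_assoc]
        refine le_mul_of_one_le_right hw0 ?_
        rw [mul_one_div, one_le_div (by positivity)]
        exact pow_le_pow_left₀ (by positivity) hS 2
  have hs := Finset.sum_le_sum fun w (_ : w ∈ Finset.univ) => hpw w
  rw [Finset.sum_sub_distrib, ← Finset.sum_mul, sum_prod_mul_sq hp.2 hg0,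
    ← Fintype.sum_pow, hp.2, one_pow, ← sum_arrow_prod] at hs
  refine le_trans (le_of_eq ?_) hs
  field_simp

/-- Slepian–Wolf coding of i.i.d. blocks with decoder side information. -/
lemma exists_blockBinning [Nonempty α] {p : α × σ → ℝ} (hp : IsPMF p) {ε lam : ℝ} (hε : 0 < ε)
    (hlam : 0 < lam) :
    ∃ j₀ : ℕ, ∀ j ≥ j₀, ∀ m : ℕ, (2 : ℝ) ^ ((j : ℝ) * (condEntropy p + 2 * ε)) ≤ m →
      ∃ (φ : (Fin j → α) → Fin m) (g : Fin m × (Fin j → σ) → (Fin j → α)),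
        1 - lam ≤ ∑ x : (Fin j → α) × (Fin j → σ),
          ind (g (φ x.1, x.2) = x.1) * ∏ i, p (x.1 i, x.2 i) := by
  obtain ⟨C, hC⟩ := prob_condTypical_ge hp hε
  have hlim : Tendsto (fun j : ℕ => C / (j : ℝ) + ((2 : ℝ) ^ (-ε)) ^ j) atTop (nhds (0 + 0)) :=
    (tendsto_const_div_atTop_nhds_zero_nat C).add
      (tendsto_pow_atTop_nhds_zero_of_lt_one (by positivity)
        (Real.rpow_lt_one_of_one_lt_of_neg one_lt_two (by linarith)))
  rw [add_zero] at hlim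
  obtain ⟨j₀, hj₀⟩ := eventually_atTop.1 (hlim.eventually (gt_mem_nhds hlam))
  refine ⟨max j₀ 1, fun j hj m hm => ?_⟩
  have hm0 : (0 : ℝ) < m := lt_of_lt_of_le (by positivity) hm
  have hprod : IsPMF fun x : (Fin j → α) × (Fin j → σ) => ∏ i, p (x.1 i, x.2 i) :=
    ⟨fun x => Finset.prod_nonneg fun i _ => hp.1 _, by
      rw [sum_arrow_prod fun w => ∏ i, p (w i), ← Fintype.sum_pow, hp.2, one_pow]⟩
  obtain ⟨φ, g, hg⟩ := exists_binning hprod (CondTypical p (j * (condEntropy p + ε)))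
    (sum_condTypical_le hp.1 _) (m := m) (by exact_mod_cast hm0)
  refine ⟨φ, g, le_trans ?_ hg⟩
  have h1 := hC j (le_trans (le_max_right _ _) hj)
  have h2 := hj₀ j (le_trans (le_max_left _ _) hj)
  have h3 : (2 : ℝ) ^ ((j : ℝ) * (condEntropy p + ε)) / m ≤ ((2 : ℝ) ^ (-ε)) ^ j := by
    rw [div_le_iff₀ hm0, ← Real.rpow_natCast, ← Real.rpow_mul two_pos.le]
    calc (2 : ℝ) ^ ((j : ℝ) * (condEntropy p + ε))
        = (2 : ℝ) ^ (-ε * j) * (2 : ℝ) ^ ((j : ℝ) * (condEntropy p + 2 * ε)) := by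
          rw [← Real.rpow_add two_pos]; ring_nf
      _ ≤ _ := by gcongr
  linarith

end SlepianWolf

section Induced

variable {L : ℕ} {U X Y : Fin L → Type} {V Z : Type}
variable [∀ l, Fintype (X l)]
variable {P Q : (((l : Fin L) → U l) × V × Z) → ℝ} {Ch : (l : Fin L) → X l → Y l → ℝ}

lemma sum_encoder_channel [∀ l, Fintype (Y l)] (hCh : ∀ l, IsKernel (Ch l)) {k n : ℕ}
    {f : (l : Fin L) → (Fin k → U l) → (Fin n → X l) → ℝ} (hf : ∀ l, IsKernel (f l))
    (u : (l : Fin L) → Fin k → U l) :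
    ∑ y : (l : Fin L) → Fin n → Y l, ∑ x : (l : Fin L) → Fin n → X l,
      (∏ l, f l (u l) (x l)) * ∏ l, ∏ j : Fin n, Ch l (x l j) (y l j) = 1 := by
  rw [Finset.sum_comm]
  have h1 : ∀ x : (l : Fin L) → Fin n → X l,
      ∑ y : (l : Fin L) → Fin n → Y l, ∏ l, ∏ j : Fin n, Ch l (x l j) (y l j) = 1 := by
    intro x
    rw [← Fintype.prod_sum (fun l (y : Fin n → Y l) => ∏ j : Fin n, Ch l (x l j) (y j))]
    refine Finset.prod_eq_one fun l _ => ?_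
    rw [← Fintype.prod_sum (fun j y => Ch l (x l j) y)]
    exact Finset.prod_eq_one fun j _ => (hCh l _).2
  simp only [← Finset.mul_sum, h1, mul_one]
  rw [← Fintype.prod_sum (fun l x => f l (u l) x)]
  exact Finset.prod_eq_one fun l _ => (hf l _).2

variable [∀ l, Fintype (U l)]

/-- The `(V, Z)` marginal of a source. -/
def sourceVZ (P : (((l : Fin L) → U l) × V × Z) → ℝ) (x : V × Z) : ℝ :=
  ∑ u : (l : Fin L) → U l, P (u, x.1, x.2)

lemma sum_source_block (P : (((l : Fin L) → U l) × V × Z) → ℝ) {k : ℕ} (v : Fin k → V)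
    (z : Fin k → Z) :
    ∑ u : (l : Fin L) → Fin k → U l, ∏ i, P ((fun l => u l i), v i, z i) =
      ∏ i, sourceVZ P (v i, z i) := by
  simp only [sourceVZ]
  rw [Fintype.prod_sum]
  exact Equiv.sum_comp (Equiv.piComm fun (l : Fin L) (_ : Fin k) => U l)
    (fun w => ∏ i, P (w i, v i, z i))

lemma sum_inducedDist_source [Fintype V] (k n : ℕ)
    (f : (l : Fin L) → (Fin k → U l) → (Fin n → X l) → ℝ)
    (y : (l : Fin L) → Fin n → Y l) (z : Fin k → Z) :
    ∑ v, inducedDist P Ch k n f (y, v, z) =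
      ∑ u : (l : Fin L) → Fin k → U l, ∑ x : (l : Fin L) → Fin n → X l,
        (∏ i : Fin k, ∑ v, P ((fun l => u l i), v, z i)) *
          ((∏ l, f l (u l) (x l)) * ∏ l, ∏ j : Fin n, Ch l (x l j) (y l j)) := by
  simp only [inducedDist]
  rw [Finset.sum_comm]
  refine Finset.sum_congr rfl fun u _ => ?_
  rw [Finset.sum_comm]
  refine Finset.sum_congr rfl fun x _ => ?_
  rw [← Finset.sum_mul, Fintype.prod_sum]

variable [∀ l, Fintype (Y l)]

lemma inducedDist_nonneg (hP : ∀ x, 0 ≤ P x) (hCh : ∀ l, IsKernel (Ch l)) {k n : ℕ}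
    {f : (l : Fin L) → (Fin k → U l) → (Fin n → X l) → ℝ} (hf : ∀ l, IsKernel (f l))
    (w : ((l : Fin L) → Fin n → Y l) × (Fin k → V) × (Fin k → Z)) :
    0 ≤ inducedDist P Ch k n f w :=
  Finset.sum_nonneg fun _ _ => Finset.sum_nonneg fun _ _ =>
    mul_nonneg (Finset.prod_nonneg fun _ _ => hP _)
      (mul_nonneg (Finset.prod_nonneg fun l _ => (hf l _).1 _)
        (Finset.prod_nonneg fun l _ => Finset.prod_nonneg fun _ _ => (hCh l _).1 _))

/-- The encoders and channels leave the law of `(V^k, Z^k)` unchanged. -/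
lemma sum_inducedDist_output (hCh : ∀ l, IsKernel (Ch l)) {k n : ℕ}
    {f : (l : Fin L) → (Fin k → U l) → (Fin n → X l) → ℝ} (hf : ∀ l, IsKernel (f l))
    (v : Fin k → V) (z : Fin k → Z) :
    ∑ y, inducedDist P Ch k n f (y, v, z) = ∏ i, sourceVZ P (v i, z i) := by
  rw [← sum_source_block P v z]
  simp only [inducedDist]
  rw [Finset.sum_comm]
  refine Finset.sum_congr rfl fun u _ => ?_
  simp only [← Finset.mul_sum]
  rw [sum_encoder_channel hCh hf, mul_one]

variable [Fintype V] [Fintype Z]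

lemma sum_sourceVZ : ∑ x, sourceVZ P x = ∑ x, P x := by
  simp only [sourceVZ]
  rw [Fintype.sum_prod_type P, Finset.sum_comm]

lemma inducedDist_isPMF (hP : IsPMF P) (hCh : ∀ l, IsKernel (Ch l)) {k n : ℕ}
    {f : (l : Fin L) → (Fin k → U l) → (Fin n → X l) → ℝ} (hf : ∀ l, IsKernel (f l)) :
    IsPMF (inducedDist P Ch k n f) := by
  refine ⟨inducedDist_nonneg hP.1 hCh hf, ?_⟩
  rw [Fintype.sum_prod_type_right]
  simp only [sum_inducedDist_output hCh hf]
  rw [sum_arrow_prod (fun w => ∏ i, sourceVZ P (w i)), ← Fintype.sum_pow, sum_sourceVZ, hP.2,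
    one_pow]

end Induced

section Blocks

variable {L : ℕ} {U X Y : Fin L → Type} {V Z : Type}
variable [∀ l, Fintype (X l)]

/-- Blockwise use of an encoder; the remaining source symbols are ignored. -/
def blockEncoder {j k₀ n₀ r k n : ℕ} (e : (Fin j × Fin k₀) ⊕ Fin r ≃ Fin k)
    (e' : Fin j × Fin n₀ ≃ Fin n)
    (f : (l : Fin L) → (Fin k₀ → U l) → (Fin n₀ → X l) → ℝ) :
    (l : Fin L) → (Fin k → U l) → (Fin n → X l) → ℝ :=
  fun l u x => ∏ a, f l (fun i => u (e (Sum.inl (a, i)))) (fun i => x (e' (a, i)))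

lemma isKernel_blockEncoder {j k₀ n₀ r k n : ℕ} (e : (Fin j × Fin k₀) ⊕ Fin r ≃ Fin k)
    (e' : Fin j × Fin n₀ ≃ Fin n)
    {f : (l : Fin L) → (Fin k₀ → U l) → (Fin n₀ → X l) → ℝ} (hf : ∀ l, IsKernel (f l))
    (l : Fin L) : IsKernel (blockEncoder e e' f l) := by
  intro u
  refine ⟨fun x => Finset.prod_nonneg fun a _ => (hf l _).1 _, ?_⟩
  let E : (Fin n → X l) ≃ (Fin j → Fin n₀ → X l) :=
    (Equiv.arrowCongr e'.symm (Equiv.refl _)).trans (Equiv.curry _ _ _)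
  have := Equiv.sum_comp E (fun b => ∏ a, f l (fun i => u (e (Sum.inl (a, i)))) (b a))
  refine Eq.trans this ?_
  rw [← Fintype.prod_sum (fun a b => f l (fun i => u (e (Sum.inl (a, i)))) b)]
  exact Finset.prod_eq_one fun a _ => (hf l _).2

variable [∀ l, Fintype (U l)]
variable {P Q : (((l : Fin L) → U l) × V × Z) → ℝ} {Ch : (l : Fin L) → X l → Y l → ℝ}

lemma IsTACI.marginals_pos [Fintype V] [Fintype Z] (hP : IsPMF P) (hQpos : ∀ x, 0 < Q x)
    (hT : IsTACI P Q) (x : ((l : Fin L) → U l) × V × Z) :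
    0 < sourceVZ P x.2 ∧ 0 < ∑ v, sourceVZ P (v, x.2.2) := by
  have h := hQpos x
  have hc : ∑ v, sourceVZ P (v, x.2.2) = ∑ u : (l : Fin L) → U l, ∑ v, P (u, v, x.2.2) := by
    simp only [sourceVZ]
    rw [Finset.sum_comm]
  have hb0 : 0 ≤ sourceVZ P x.2 := Finset.sum_nonneg fun _ _ => hP.1 _
  have hc0 : 0 ≤ ∑ v, sourceVZ P (v, x.2.2) :=
    Finset.sum_nonneg fun _ _ => Finset.sum_nonneg fun _ _ => hP.1 _
  rw [hT x, ← hc] at h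
  refine ⟨hb0.lt_of_ne fun he => ?_, hc0.lt_of_ne fun he => ?_⟩
  · rw [sourceVZ] at he
    simp [← he] at h
  · simp [← he] at h

/-- Under conditional independence the output `Y` is generated from `Z^k` alone. -/
lemma IsTACI.inducedDist_eq [Fintype V] (hT : IsTACI P Q) (k n : ℕ)
    (f : (l : Fin L) → (Fin k → U l) → (Fin n → X l) → ℝ)
    (y : (l : Fin L) → Fin n → Y l) (v : Fin k → V) (z : Fin k → Z) :
    inducedDist Q Ch k n f (y, v, z) =
      (∏ i, (sourceVZ P (v i, z i) / ∑ v', sourceVZ P (v', z i))) *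
        ∑ v', inducedDist P Ch k n f (y, v', z) := by
  rw [sum_inducedDist_source]
  simp only [inducedDist, Finset.mul_sum, ← mul_assoc, ← Finset.prod_mul_distrib]
  refine Finset.sum_congr rfl fun u _ => Finset.sum_congr rfl fun x _ => ?_
  congr 3
  funext i
  rw [hT, ← Finset.mul_sum]
  simp only [sourceVZ]
  rw [Finset.sum_comm (f := fun v u => P (u, v, z i))]
  ring

/-- `D(P_{YVZ} ‖ Q_{YVZ}) = k H(V|Z) - H(V^k | Y, Z^k)` when testing against conditional
independence. -/
lemma IsTACI.klDiv_inducedDist [∀ l, Fintype (Y l)] [Fintype V] [Fintype Z] (hP : IsPMF P)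
    (hQpos : ∀ x, 0 < Q x) (hT : IsTACI P Q) (hCh : ∀ l, IsKernel (Ch l)) {k n : ℕ}
    {f : (l : Fin L) → (Fin k → U l) → (Fin n → X l) → ℝ} (hf : ∀ l, IsKernel (f l)) :
    klDiv (inducedDist P Ch k n f) (inducedDist Q Ch k n f) =
      k * condEntropy (sourceVZ P) - condEntV P Ch k n f := by
  obtain ⟨x₀, -⟩ : (Finset.univ : Finset (((l : Fin L) → U l) × V × Z)).Nonempty :=
    Finset.nonempty_of_sum_ne_zero (hP.2.trans_ne one_ne_zero)
  have hpos := fun x : V × Z => hT.marginals_pos hP hQpos (x₀.1, x)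
  set D := inducedDist P Ch k n f with hD
  have hD0 : ∀ w, 0 ≤ D w := inducedDist_nonneg hP.1 hCh hf
  set g : V × Z → ℝ := fun x => Real.logb 2 (sourceVZ P x / ∑ v, sourceVZ P (v, x.2)) with hg
  have hterm : ∀ w, D w * Real.logb 2 (D w / inducedDist Q Ch k n f w) =
      D w * Real.logb 2 (D w / ∑ v, D (w.1, v, w.2.2)) -
        D w * ∑ i, g (w.2.1 i, w.2.2 i) := by
    rintro ⟨y, v, z⟩
    rcases (hD0 (y, v, z)).eq_or_lt with h0 | h0
    · simp [← h0]
    · have hm : 0 < ∑ v, D (y, v, z) := h0.trans_le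
        (Finset.single_le_sum (f := fun v => D (y, v, z)) (fun _ _ => hD0 _) (Finset.mem_univ v))
      have hr : ∀ i, 0 < sourceVZ P (v i, z i) / ∑ v', sourceVZ P (v', z i) := fun i =>
        div_pos (hpos (v i, z i)).1 (hpos (v i, z i)).2
      have hr' : 0 < ∏ i, (sourceVZ P (v i, z i) / ∑ v', sourceVZ P (v', z i)) :=
        Finset.prod_pos fun i _ => hr i
      rw [hT.inducedDist_eq, ← hD, mul_comm (∏ i, _), ← div_div,
        Real.logb_div (div_pos h0 hm).ne' hr'.ne', mul_sub,
        Real.logb_prod _ _ fun i _ => (hr i).ne']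
  have h2 : ∑ w, D w * ∑ i, g (w.2.1 i, w.2.2 i) = k * ∑ x, sourceVZ P x * g x := by
    rw [Fintype.sum_prod_type_right]
    simp only [← Finset.sum_mul, hD, sum_inducedDist_output hCh hf]
    rw [sum_arrow_prod (fun w => (∏ i, sourceVZ P (w i)) * ∑ i, g (w i)),
      sum_prod_mul_sum (by rw [sum_sourceVZ, hP.2])]
  have h1 : condEntV P Ch k n f = -∑ w, D w * Real.logb 2 (D w / ∑ v, D (w.1, v, w.2.2)) := by
    unfold condEntV condEntropy
    congr 1
    simp only [Fintype.sum_prod_type]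
    exact Finset.sum_comm
  unfold klDiv
  rw [Finset.sum_congr rfl fun w _ => hterm w, Finset.sum_sub_distrib, h2, h1, condEntropy]
  ring

/-- Splitting a sequence indexed by `K` into `J` blocks and a remainder. -/
def blockEquiv {J K₀ T K : Type*} (e : (J × K₀) ⊕ T ≃ K) (A : Type*) :
    (K → A) ≃ (J → K₀ → A) × (T → A) :=
  (Equiv.arrowCongr e.symm (Equiv.refl A)).trans
    ((Equiv.sumArrowEquivProdArrow _ _ _).trans
      (Equiv.prodCongr (Equiv.curry _ _ _) (Equiv.refl _)))

@[simp] lemma blockEquiv_apply_fst {J K₀ T K : Type*} (e : (J × K₀) ⊕ T ≃ K) (A : Type*)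
    (w : K → A) (j : J) (i : K₀) : (blockEquiv e A w).1 j i = w (e (Sum.inl (j, i))) := rfl

@[simp] lemma blockEquiv_apply_snd {J K₀ T K : Type*} (e : (J × K₀) ⊕ T ≃ K) (A : Type*)
    (w : K → A) (t : T) : (blockEquiv e A w).2 t = w (e (Sum.inr t)) := rfl

/-- Splitting a tuple of sequences, indexed by `ι`, into `J` blocks and a remainder. -/
def tupleBlockEquiv {ι J K₀ T K : Type*} (e : (J × K₀) ⊕ T ≃ K) (A : ι → Type*) :
    ((l : ι) → K → A l) ≃ (J → (l : ι) → K₀ → A l) × (T → (l : ι) → A l) where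
  toFun u := (fun j l i => u l (e (Sum.inl (j, i))), fun t l => u l (e (Sum.inr t)))
  invFun b l i := Sum.elim (fun q => b.1 q.1 l q.2) (fun t => b.2 t l) (e.symm i)
  left_inv u := by
    funext l i
    obtain ⟨q | t, rfl⟩ := e.surjective i <;> simp
  right_inv b := by
    simp

/-- Splitting a tuple of sequences, indexed by `ι`, into `J` blocks without remainder. -/
def tupleCurryEquiv {ι J N₀ N : Type*} (e : J × N₀ ≃ N) (A : ι → Type*) :
    ((l : ι) → N → A l) ≃ (J → (l : ι) → N₀ → A l) where
  toFun x j l i := x l (e (j, i))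
  invFun b l i := b (e.symm i).1 l (e.symm i).2
  left_inv x := by simp
  right_inv b := by simp

lemma inducedDist_blockEncoder {j k₀ n₀ r k n : ℕ} (e : (Fin j × Fin k₀) ⊕ Fin r ≃ Fin k)
    (e' : Fin j × Fin n₀ ≃ Fin n)
    (f : (l : Fin L) → (Fin k₀ → U l) → (Fin n₀ → X l) → ℝ)
    (y : (l : Fin L) → Fin n → Y l) (v : Fin k → V) (z : Fin k → Z) :
    inducedDist P Ch k n (blockEncoder e e' f) (y, v, z) =
      (∏ a, inducedDist P Ch k₀ n₀ f
        (tupleCurryEquiv e' Y y a, (blockEquiv e V v).1 a, (blockEquiv e Z z).1 a)) *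
      ∏ t, sourceVZ P ((blockEquiv e V v).2 t, (blockEquiv e Z z).2 t) := by
  set F : (Fin j → (l : Fin L) → Fin k₀ → U l) → (Fin j → (l : Fin L) → Fin n₀ → X l) → ℝ :=
    fun ub xb => ∏ a, ((∏ i, P ((fun l => ub a l i), v (e (Sum.inl (a, i))),
      z (e (Sum.inl (a, i))))) * ((∏ l, f l (ub a l) (xb a l)) *
        ∏ l, ∏ i, Ch l (xb a l i) (y l (e' (a, i))))) with hF
  set G : (Fin r → (l : Fin L) → U l) → ℝ :=
    fun ut => ∏ t, P (ut t, v (e (Sum.inr t)), z (e (Sum.inr t))) with hG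
  have h1 : inducedDist P Ch k n (blockEncoder e e' f) (y, v, z) =
      ∑ u : (l : Fin L) → Fin k → U l, ∑ x : (l : Fin L) → Fin n → X l,
        F (tupleBlockEquiv e U u).1 (tupleCurryEquiv e' X x) * G (tupleBlockEquiv e U u).2 := by
    refine Finset.sum_congr rfl fun u _ => Finset.sum_congr rfl fun x _ => ?_
    simp only [hF, hG, tupleBlockEquiv, tupleCurryEquiv, Equiv.coe_fn_mk, blockEncoder,
      Finset.prod_mul_distrib]
    rw [← Equiv.prod_comp e, Fintype.prod_sum_type, Fintype.prod_prod_type,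
      Finset.prod_comm (s := (Finset.univ : Finset (Fin L))) (t := (Finset.univ : Finset (Fin j)))]
    have : ∏ l, ∏ i, Ch l (x l i) (y l i) =
        ∏ a, ∏ l, ∏ i, Ch l (x l (e' (a, i))) (y l (e' (a, i))) := by
      rw [Finset.prod_comm (s := (Finset.univ : Finset (Fin j)))]
      refine Finset.prod_congr rfl fun l _ => ?_
      rw [← Equiv.prod_comp e', Fintype.prod_prod_type]
    rw [this]
    ring
  rw [h1]
  have h2 : ∀ (ub : Fin j → (l : Fin L) → Fin k₀ → U l) (ut : Fin r → (l : Fin L) → U l),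
      ∑ x, F ub (tupleCurryEquiv e' X x) * G ut = ∑ xb, F ub xb * G ut := fun ub ut =>
    Equiv.sum_comp (tupleCurryEquiv e' X) (fun xb => F ub xb * G ut)
  simp only [h2]
  rw [Equiv.sum_comp (tupleBlockEquiv e U) (fun b => ∑ xb, F b.1 xb * G b.2),
    Fintype.sum_prod_type]
  simp only [← Finset.sum_mul, ← Finset.mul_sum]
  congr 1
  · simp only [hF, inducedDist]
    rw [Fintype.prod_sum]
    refine Finset.sum_congr rfl fun ub _ => ?_
    rw [Fintype.prod_sum]
    rfl
  · simp only [hG, sourceVZ]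
    rw [Fintype.prod_sum]
    rfl

end Blocks

section Coding

variable {L : ℕ} {U X Y : Fin L → Type} {V Z : Type}
lemma sum_reorder {A B C : Type*} [Fintype A] [Fintype B] [Fintype C] (F : A × B × C → ℝ) :
    ∑ x : B × (A × C), F (x.2.1, x.1, x.2.2) = ∑ w, F w := by
  simp only [Fintype.sum_prod_type]
  exact Finset.sum_comm

/-- The trivial encoder, which does not use the channel. -/
lemma isKernel_trivial [∀ l, Fintype (X l)] {k : ℕ} (l : Fin L) :
    IsKernel (fun (_ : Fin k → U l) (_ : Fin 0 → X l) => (1 : ℝ)) :=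
  fun _ => ⟨fun _ => zero_le_one, by simp⟩

lemma logb_card_arrow [Fintype V] [Nonempty V] (k : ℕ) :
    Real.logb 2 (Fintype.card (Fin k → V)) = k * Real.logb 2 (Fintype.card V) := by
  rw [Fintype.card_fun, Fintype.card_fin]
  push_cast
  exact Real.logb_pow _ _ _

variable [∀ l, Fintype (U l)] [∀ l, Fintype (X l)] [∀ l, Fintype (Y l)]
variable [Fintype V] [Fintype Z]
variable {P : (((l : Fin L) → U l) × V × Z) → ℝ} {Ch : (l : Fin L) → X l → Y l → ℝ}

/-- The induced law regarded as a law on `V^k × (Y, Z^k)`. -/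
lemma isPMF_inducedDist_reorder (hP : IsPMF P) (hCh : ∀ l, IsKernel (Ch l)) {k n : ℕ}
    {f : (l : Fin L) → (Fin k → U l) → (Fin n → X l) → ℝ} (hf : ∀ l, IsKernel (f l)) :
    IsPMF fun x : (Fin k → V) × (((l : Fin L) → Fin n → Y l) × (Fin k → Z)) =>
      inducedDist P Ch k n f (x.2.1, x.1, x.2.2) :=
  ⟨fun _ => inducedDist_nonneg hP.1 hCh hf _,
    (sum_reorder _).trans (inducedDist_isPMF hP hCh hf).2⟩

lemma condEntV_nonneg (hP : IsPMF P) (hCh : ∀ l, IsKernel (Ch l)) {k n : ℕ}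
    {f : (l : Fin L) → (Fin k → U l) → (Fin n → X l) → ℝ} (hf : ∀ l, IsKernel (f l)) :
    0 ≤ condEntV P Ch k n f :=
  condEntropy_nonneg (isPMF_inducedDist_reorder hP hCh hf).1

/-- Converse part of the `L`-helper problem. -/
lemma JSCCAchievable.le_rate [Nonempty V] (hP : IsPMF P) (hCh : ∀ l, IsKernel (Ch l))
    {τ R B : ℝ} (hB : ∀ k : ℕ, 1 ≤ k → ∀ n : ℕ, (n : ℝ) ≤ τ * k →
      ∀ f : (l : Fin L) → (Fin k → U l) → (Fin n → X l) → ℝ, (∀ l, IsKernel (f l)) →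
        B * k ≤ condEntV P Ch k n f)
    (hR : JSCCAchievable P Ch τ R) : B ≤ R := by
  set N : ℝ := Real.logb 2 (Fintype.card V) with hN
  have main : ∀ lam : ℝ, 0 < lam → lam ≤ 1 → B ≤ R + lam * N := by
    intro lam hlam hlam1
    obtain ⟨nseq, mseq, δ, f, φ, g, -, hδ, h⟩ := hR lam hlam hlam1
    have hlim : Tendsto (fun k : ℕ => 1 / (k : ℝ) + (R + δ k) + lam * N) atTop
        (nhds (0 + (R + 0) + lam * N)) :=
      ((tendsto_const_div_atTop_nhds_zero_nat 1).add (tendsto_const_nhds.add hδ)).add_const _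
    have hb : B ≤ 0 + (R + 0) + lam * N := by
      refine ge_of_tendsto hlim (eventually_atTop.2 ⟨1, fun k hk => ?_⟩)
      obtain ⟨hn, hm, hf, hc, hr⟩ := h k hk
      have hk0 : (0 : ℝ) < k := by exact_mod_cast hk
      have hF := condEntropy_le_of_decoder (isPMF_inducedDist_reorder hP hCh hf) hm (φ k) (g k)
        (lam := lam) (hc.trans (le_of_eq (sum_reorder fun w : ((l : Fin L) → Fin (nseq k) → Y l) ×
          (Fin k → V) × (Fin k → Z) => ind (g k (φ k w.2.1, w.1, w.2.2) = w.2.1) *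
            inducedDist P Ch k (nseq k) (f k) w).symm))
      rw [logb_card_arrow, ← hN] at hF
      have hle := (hB k hk _ hn _ hf).trans hF
      rw [div_le_iff₀ hk0] at hr
      refine le_of_mul_le_mul_right ?_ hk0
      have e : (1 / (k : ℝ) + (R + δ k) + lam * N) * k = 1 + (R + δ k) * k + lam * (k * N) := by
        field_simp
      rw [e]
      linarith
    linarith
  have hlim : Tendsto (fun i : ℕ => R + 1 / ((i : ℝ) + 1) * N) atTop (nhds (R + 0 * N)) :=
    tendsto_const_nhds.add (tendsto_one_div_add_atTop_nhds_zero_nat.mul_const _)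
  have := ge_of_tendsto' hlim fun i : ℕ => main (1 / ((i : ℝ) + 1)) (by positivity)
    ((div_le_one (by positivity)).2 (by linarith [(Nat.cast_nonneg i : (0 : ℝ) ≤ i)]))
  linarith

/-- Sending `V^k` uncoded over the noiseless link. -/
lemma probCorrect_uncoded (hP : IsPMF P) (hCh : ∀ l, IsKernel (Ch l)) (k : ℕ)
    {m : ℕ} (e : (Fin k → V) ≃ Fin m) :
    probCorrect P Ch k 0 m (fun _ _ _ => 1) e (fun b => e.symm b.1) = 1 := by
  simp [probCorrect, ind_true, (inducedDist_isPMF hP hCh isKernel_trivial).2]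

/-- Blockwise coding over the helpers' channels, with the remainder of `V^k` sent uncoded. -/
lemma probCorrect_blockEncoder (hP : IsPMF P) {j k₀ n₀ r k n m₁ m₂ : ℕ}
    (e : (Fin j × Fin k₀) ⊕ Fin r ≃ Fin k) (e' : Fin j × Fin n₀ ≃ Fin n)
    (eV : (Fin r → V) ≃ Fin m₂)
    (f : (l : Fin L) → (Fin k₀ → U l) → (Fin n₀ → X l) → ℝ)
    (φ : (Fin j → Fin k₀ → V) → Fin m₁)
    (g : Fin m₁ × (Fin j → ((l : Fin L) → Fin n₀ → Y l) × (Fin k₀ → Z)) → (Fin j → Fin k₀ → V)) :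
    probCorrect P Ch k n (m₁ * m₂) (blockEncoder e e' f)
      (fun v => finProdFinEquiv (φ (blockEquiv e V v).1, eV (blockEquiv e V v).2))
      (fun b => (blockEquiv e V).symm
        (g ((finProdFinEquiv.symm b.1).1,
          fun a => (tupleCurryEquiv e' Y b.2.1 a, (blockEquiv e Z b.2.2).1 a)),
          eV.symm (finProdFinEquiv.symm b.1).2)) =
    ∑ x : (Fin j → Fin k₀ → V) × (Fin j → ((l : Fin L) → Fin n₀ → Y l) × (Fin k₀ → Z)),
      ind (g (φ x.1, x.2) = x.1) *
        ∏ i, inducedDist P Ch k₀ n₀ f ((x.2 i).1, x.1 i, (x.2 i).2) := by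
  have hrem : ∑ t : (Fin r → V) × (Fin r → Z), ∏ i, sourceVZ P (t.1 i, t.2 i) = 1 := by
    rw [sum_arrow_prod (fun w => ∏ i, sourceVZ P (w i)), ← Fintype.sum_pow, sum_sourceVZ, hP.2,
      one_pow]
  set F : (Fin j → Fin k₀ → V) → (Fin j → (l : Fin L) → Fin n₀ → Y l) → (Fin j → Fin k₀ → Z) → ℝ :=
    fun vb yb zb => ind (g (φ vb, fun a => (yb a, zb a)) = vb) *
      ∏ i, inducedDist P Ch k₀ n₀ f (yb i, vb i, zb i) with hF
  set G : (Fin r → V) → (Fin r → Z) → ℝ := fun vt zt => ∏ i, sourceVZ P (vt i, zt i) with hG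
  have hterm : ∀ (y : (l : Fin L) → Fin n → Y l) (v : Fin k → V) (z : Fin k → Z),
      ind ((blockEquiv e V).symm (g (φ (blockEquiv e V v).1,
          fun a => (tupleCurryEquiv e' Y y a, (blockEquiv e Z z).1 a)), (blockEquiv e V v).2) = v) *
        inducedDist P Ch k n (blockEncoder e e' f) (y, v, z) =
      F (blockEquiv e V v).1 (tupleCurryEquiv e' Y y) (blockEquiv e Z z).1 *
        G (blockEquiv e V v).2 (blockEquiv e Z z).2 := by
    intro y v z
    rw [inducedDist_blockEncoder, ← mul_assoc, Equiv.symm_apply_eq, Prod.ext_iff]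
    simp [hF, hG]
  have hV : ∀ H : (Fin j → Fin k₀ → V) × (Fin r → V) → ℝ,
      ∑ v, H (blockEquiv e V v) = ∑ b, H b := Equiv.sum_comp _
  have hZ : ∀ H : (Fin j → Fin k₀ → Z) × (Fin r → Z) → ℝ,
      ∑ z, H (blockEquiv e Z z) = ∑ b, H b := Equiv.sum_comp _
  have hY : ∀ H : (Fin j → (l : Fin L) → Fin n₀ → Y l) → ℝ,
      ∑ y, H (tupleCurryEquiv e' Y y) = ∑ b, H b := Equiv.sum_comp _
  have hL : probCorrect P Ch k n (m₁ * m₂) (blockEncoder e e' f)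
      (fun v => finProdFinEquiv (φ (blockEquiv e V v).1, eV (blockEquiv e V v).2))
      (fun b => (blockEquiv e V).symm
        (g ((finProdFinEquiv.symm b.1).1,
          fun a => (tupleCurryEquiv e' Y b.2.1 a, (blockEquiv e Z b.2.2).1 a)),
          eV.symm (finProdFinEquiv.symm b.1).2)) =
      ∑ y : (l : Fin L) → Fin n → Y l, ∑ v : Fin k → V, ∑ z : Fin k → Z,
        F (blockEquiv e V v).1 (tupleCurryEquiv e' Y y) (blockEquiv e Z z).1 *
          G (blockEquiv e V v).2 (blockEquiv e Z z).2 := by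
    unfold probCorrect
    simp only [Fintype.sum_prod_type]
    refine Finset.sum_congr rfl fun y _ => Finset.sum_congr rfl fun v _ =>
      Finset.sum_congr rfl fun z _ => ?_
    rw [← hterm]
    simp only [Equiv.symm_apply_apply]
  rw [hL, hY fun yb => ∑ v : Fin k → V, ∑ z : Fin k → Z,
    F (blockEquiv e V v).1 yb (blockEquiv e Z z).1 * G (blockEquiv e V v).2 (blockEquiv e Z z).2]
  have hR : ∑ x : (Fin j → Fin k₀ → V) ×
      (Fin j → ((l : Fin L) → Fin n₀ → Y l) × (Fin k₀ → Z)),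
      ind (g (φ x.1, x.2) = x.1) *
        ∏ i, inducedDist P Ch k₀ n₀ f ((x.2 i).1, x.1 i, (x.2 i).2) =
      ∑ yb, ∑ vb, ∑ zb, F vb yb zb := by
    rw [Fintype.sum_prod_type, Finset.sum_comm]
    rw [← sum_arrow_prod, Fintype.sum_prod_type]
    refine Finset.sum_congr rfl fun yb _ => ?_
    rw [Finset.sum_comm]
  rw [hR]
  refine Finset.sum_congr rfl fun yb _ => ?_
  have h1 : ∀ v : Fin k → V, ∑ z : Fin k → Z,
      F (blockEquiv e V v).1 yb (blockEquiv e Z z).1 *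
        G (blockEquiv e V v).2 (blockEquiv e Z z).2 =
      (∑ zb, F (blockEquiv e V v).1 yb zb) * ∑ zt, G (blockEquiv e V v).2 zt := by
    intro v
    rw [hZ fun b => F (blockEquiv e V v).1 yb b.1 * G (blockEquiv e V v).2 b.2,
      Fintype.sum_prod_type, Finset.sum_mul_sum]
  simp only [h1]
  rw [hV fun b => (∑ zb, F b.1 yb zb) * ∑ zt, G b.2 zt, Fintype.sum_prod_type]
  simp only
  rw [← Finset.sum_mul_sum, ← Fintype.sum_prod_type (fun t : (Fin r → V) × (Fin r → Z) =>
    G t.1 t.2), hrem, mul_one]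

/-- Direct part of the `L`-helper problem: Slepian–Wolf coding on top of a helper scheme. -/
lemma jsccAchievable_of_lt [Nonempty V] (hP : IsPMF P) (hCh : ∀ l, IsKernel (Ch l))
    {τ R : ℝ} (hτ : 0 ≤ τ) {k₀ n₀ : ℕ} (hk₀ : 1 ≤ k₀) (hn₀ : (n₀ : ℝ) ≤ τ * k₀)
    {f₀ : (l : Fin L) → (Fin k₀ → U l) → (Fin n₀ → X l) → ℝ} (hf₀ : ∀ l, IsKernel (f₀ l))
    (hR : condEntV P Ch k₀ n₀ f₀ / k₀ < R) : JSCCAchievable P Ch τ R := by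
  intro lam hlam _
  have hk₀' : (0 : ℝ) < k₀ := by exact_mod_cast hk₀
  set c := condEntV P Ch k₀ n₀ f₀ with hc
  have hc0 : 0 ≤ c := condEntV_nonneg hP hCh hf₀
  have hR0 : 0 ≤ R := (div_nonneg hc0 hk₀'.le).trans hR.le
  rw [div_lt_iff₀ hk₀'] at hR
  obtain ⟨j₀, hj₀⟩ := exists_blockBinning (isPMF_inducedDist_reorder hP hCh hf₀)
    (ε := (R * k₀ - c) / 2) (by linarith) hlam
  set N : ℝ := Real.logb 2 (Fintype.card V) with hN
  have hcard : (1 : ℝ) ≤ Fintype.card V := by exact_mod_cast Fintype.card_pos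
  have hN0 : 0 ≤ N := Real.logb_nonneg one_lt_two hcard
  set C : ℝ := 1 + k₀ * N + k₀ * j₀ * N with hC
  have hC0 : 0 ≤ C := by positivity
  have claim : ∀ k : ℕ, ∃ (n m : ℕ) (f : (l : Fin L) → (Fin k → U l) → (Fin n → X l) → ℝ)
      (φ : (Fin k → V) → Fin m)
      (g : Fin m × ((l : Fin L) → Fin n → Y l) × (Fin k → Z) → (Fin k → V)),
      (n : ℝ) ≤ τ * k ∧ 1 ≤ m ∧ (∀ l, IsKernel (f l)) ∧ 1 - lam ≤ probCorrect P Ch k n m f φ g ∧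
        Real.logb 2 m ≤ R * k + C := by
    intro k
    have hdm : k / k₀ * k₀ + k % k₀ = k := Nat.div_add_mod' k k₀
    have hr : k % k₀ < k₀ := Nat.mod_lt _ hk₀
    set j := k / k₀
    set r := k % k₀
    have hk : (k : ℝ) = j * k₀ + r := by exact_mod_cast hdm.symm
    have hr' : (r : ℝ) ≤ k₀ := by exact_mod_cast hr.le
    rcases lt_or_ge j j₀ with hj | hj
    · refine ⟨0, Fintype.card (Fin k → V), fun _ _ _ => 1, Fintype.equivFin _,
        fun b => (Fintype.equivFin _).symm b.1, ?_, Fintype.card_pos, isKernel_trivial, ?_, ?_⟩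
      · simp only [Nat.cast_zero]
        positivity
      · rw [probCorrect_uncoded hP hCh]
        linarith
      · rw [logb_card_arrow, ← hN]
        have hj' : (j : ℝ) ≤ j₀ := by exact_mod_cast hj.le
        have h1 : (k : ℝ) ≤ k₀ + k₀ * j₀ := by nlinarith
        have h2 := mul_le_mul_of_nonneg_right h1 hN0
        have h3 : 0 ≤ R * k := by positivity
        linarith
    · set a : ℝ := (j : ℝ) * (R * k₀) with ha
      have ha0 : 0 ≤ a := by positivity
      obtain ⟨φ, g, hg⟩ := hj₀ j hj ⌈(2 : ℝ) ^ a⌉₊ (by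
        refine le_trans (le_of_eq ?_) (Nat.le_ceil _)
        change (2 : ℝ) ^ ((j : ℝ) * (c + 2 * ((R * k₀ - c) / 2))) = _
        rw [ha]
        ring_nf)
      have hm₁ : 0 < ⌈(2 : ℝ) ^ a⌉₊ := Nat.ceil_pos.2 (by positivity)
      let e : (Fin j × Fin k₀) ⊕ Fin r ≃ Fin k :=
        (Equiv.sumCongr finProdFinEquiv (Equiv.refl _)).trans
          (finSumFinEquiv.trans (finCongr hdm))
      refine ⟨j * n₀, ⌈(2 : ℝ) ^ a⌉₊ * Fintype.card (Fin r → V),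
        blockEncoder e finProdFinEquiv f₀, _, _, ?_, Nat.mul_pos hm₁ Fintype.card_pos,
        isKernel_blockEncoder e _ hf₀,
        hg.trans (probCorrect_blockEncoder hP e finProdFinEquiv (Fintype.equivFin _) f₀ φ g).ge, ?_⟩
      · push_cast
        calc (j : ℝ) * n₀ ≤ j * (τ * k₀) := by gcongr
          _ ≤ τ * k := by
            rw [hk]
            nlinarith [mul_nonneg hτ (Nat.cast_nonneg r : (0 : ℝ) ≤ r)]
      · have hm₁' : (0 : ℝ) < ⌈(2 : ℝ) ^ a⌉₊ := by exact_mod_cast hm₁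
        have hcr : ((Fintype.card (Fin r → V) : ℕ) : ℝ) ≠ 0 := by
          exact_mod_cast Fintype.card_ne_zero
        rw [Nat.cast_mul, Real.logb_mul hm₁'.ne' hcr, logb_card_arrow, ← hN]
        have h2a : (1 : ℝ) ≤ 2 ^ a := Real.one_le_rpow one_le_two ha0
        have hle : (⌈(2 : ℝ) ^ a⌉₊ : ℝ) ≤ 2 ^ (a + 1) := by
          rw [Real.rpow_add two_pos, Real.rpow_one]
          linarith [Nat.ceil_lt_add_one (zero_le_one.trans h2a)]
        have hlog := Real.logb_le_logb_of_le one_lt_two hm₁' hle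
        rw [Real.logb_rpow two_pos (by norm_num)] at hlog
        have h1 : a ≤ R * k := by
          rw [ha, hk]
          nlinarith [mul_nonneg hR0 (Nat.cast_nonneg r : (0 : ℝ) ≤ r)]
        have h2 := mul_le_mul_of_nonneg_right hr' hN0
        have h3 : 0 ≤ (k₀ : ℝ) * j₀ * N := by positivity
        linarith
  choose nseq mseq f φ g h using claim
  refine ⟨nseq, mseq, fun k => C / k, f, φ, g, fun k => by positivity,
    tendsto_const_div_atTop_nhds_zero_nat C, fun k hk => ?_⟩
  obtain ⟨h1, h2, h3, h4, h5⟩ := h k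
  have hk0 : (0 : ℝ) < k := by exact_mod_cast hk
  refine ⟨h1, h2, h3, h4, ?_⟩
  rw [div_le_iff₀ hk0, add_mul, div_mul_cancel₀ _ hk0.ne']
  exact h5

end Coding

end DHT

/-- For the TACI problem with bandwidth ratio `τ > 0`,
`θ(τ) = H(V|Z) − R(τ)` where `R(τ)` is the optimal rate of the `L`-helper JSCC problem
with the `H₀` source distribution, the same channels and the same bandwidth ratio. -/
theorem statement_8 {L : ℕ} {U X Y : Fin L → Type} {V Z : Type}
    [∀ l, Fintype (U l)] [∀ l, Fintype (X l)] [∀ l, Fintype (Y l)]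
    [Fintype V] [Fintype Z]
    (P Q : (((l : Fin L) → U l) × V × Z) → ℝ)
    (hP : IsPMF P) (hQ : IsPMF Q) (hQpos : ∀ x, 0 < Q x)
    (hTACI : IsTACI P Q)
    (Ch : (l : Fin L) → X l → Y l → ℝ) (hCh : ∀ l, IsKernel (Ch l))
    (τ : ℝ) (hτ : 0 < τ) :
    theta P Q Ch τ =
      condEntropy (fun x : V × Z => ∑ u : (l : Fin L) → U l, P (u, x.1, x.2)) -
        Rjscc P Ch τ := by
  obtain ⟨x₀, -⟩ : (Finset.univ : Finset (((l : Fin L) → U l) × V × Z)).Nonempty :=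
    Finset.nonempty_of_sum_ne_zero (hP.2.trans_ne one_ne_zero)
  have : Nonempty V := ⟨x₀.2.1⟩
  change theta P Q Ch τ = condEntropy (sourceVZ P) - Rjscc P Ch τ
  set H := condEntropy (sourceVZ P)
  have hkl : ∀ k : ℕ, 1 ≤ k → ∀ n : ℕ,
      ∀ f : (l : Fin L) → (Fin k → U l) → (Fin n → X l) → ℝ, (∀ l, IsKernel (f l)) →
        klDiv (inducedDist P Ch k n f) (inducedDist Q Ch k n f) / k =
          H - condEntV P Ch k n f / k := by
    intro k hk n f hf
    have hk0 : (k : ℝ) ≠ 0 := by positivity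
    rw [hTACI.klDiv_inducedDist hP hQpos hCh hf]
    field_simp
    rfl
  have hdiv : ∀ (k n : ℕ) (f : (l : Fin L) → (Fin k → U l) → (Fin n → X l) → ℝ),
      (∀ l, IsKernel (f l)) → 0 ≤ condEntV P Ch k n f / k := fun k n f hf =>
    div_nonneg (condEntV_nonneg hP hCh hf) k.cast_nonneg
  have hne : ∀ k : ℕ, {d | ∃ n : ℕ, (n : ℝ) ≤ τ * k ∧
      ∃ f : (l : Fin L) → (Fin k → U l) → (Fin n → X l) → ℝ, (∀ l, IsKernel (f l)) ∧
        d = klDiv (inducedDist P Ch k n f) (inducedDist Q Ch k n f) / k}.Nonempty := fun k =>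
    ⟨_, 0, by rw [Nat.cast_zero]; positivity, _, isKernel_trivial, rfl⟩
  have hthetaK : ∀ (B : ℝ) (k : ℕ), 1 ≤ k → (∀ n : ℕ, (n : ℝ) ≤ τ * k →
      ∀ f : (l : Fin L) → (Fin k → U l) → (Fin n → X l) → ℝ, (∀ l, IsKernel (f l)) →
        B ≤ condEntV P Ch k n f / k) → thetaK P Q Ch τ k ≤ H - B := by
    intro B k hk hB
    refine csSup_le (hne k) ?_
    rintro d ⟨n, hn, f, hf, rfl⟩
    rw [hkl k hk n f hf]
    linarith [hB n hn f hf]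
  have hthetaBdd : BddAbove {d | ∃ k : ℕ, 1 ≤ k ∧ d = thetaK P Q Ch τ k} := by
    refine ⟨H - 0, ?_⟩
    rintro d ⟨k, hk, rfl⟩
    exact hthetaK 0 k hk fun n _ f hf => hdiv k n f hf
  have hlow : ∀ k : ℕ, 1 ≤ k → ∀ n : ℕ, (n : ℝ) ≤ τ * k →
      ∀ f : (l : Fin L) → (Fin k → U l) → (Fin n → X l) → ℝ, (∀ l, IsKernel (f l)) →
        (H - theta P Q Ch τ) * k ≤ condEntV P Ch k n f := by
    intro k hk n hn f hf
    have hk0 : (0 : ℝ) < k := by exact_mod_cast hk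
    have h1 : H - condEntV P Ch k n f / k ≤ thetaK P Q Ch τ k := by
      refine le_csSup ⟨H, ?_⟩ ⟨n, hn, f, hf, (hkl k hk n f hf).symm⟩
      rintro d ⟨n', -, f', hf', rfl⟩
      rw [hkl k hk n' f' hf']
      linarith [hdiv k n' f' hf']
    have h2 : thetaK P Q Ch τ k ≤ theta P Q Ch τ := le_csSup hthetaBdd ⟨k, hk, rfl⟩
    rw [← le_div_iff₀ hk0]
    linarith
  have hconv : ∀ R, JSCCAchievable P Ch τ R → H - theta P Q Ch τ ≤ R := fun R hR =>
    hR.le_rate hP hCh hlow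
  have hRle : ∀ k : ℕ, 1 ≤ k → ∀ n : ℕ, (n : ℝ) ≤ τ * k →
      ∀ f : (l : Fin L) → (Fin k → U l) → (Fin n → X l) → ℝ, (∀ l, IsKernel (f l)) →
        Rjscc P Ch τ ≤ condEntV P Ch k n f / k := fun k hk n hn f hf =>
    le_of_forall_gt_imp_ge_of_dense fun R hR =>
      csInf_le ⟨_, hconv⟩ (jsccAchievable_of_lt hP hCh hτ.le hk hn hf hR)
  apply le_antisymm
  · refine csSup_le ⟨_, 1, le_rfl, rfl⟩ ?_
    rintro d ⟨k, hk, rfl⟩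
    exact hthetaK _ k hk (hRle k hk)
  · have hach : {R | JSCCAchievable P Ch τ R}.Nonempty :=
      ⟨_, jsccAchievable_of_lt hP hCh hτ.le (k₀ := 1) (n₀ := 0) le_rfl
        (by rw [Nat.cast_zero]; positivity) isKernel_trivial (lt_add_one _)⟩
    linarith [le_csInf hach hconv, show Rjscc P Ch τ = sInf {R | JSCCAchievable P Ch τ R} from rfl]
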